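/- arXiv:0712.0792 — 2 statements merged into one kernel-verified Lean document; each statement's English description precedes it below -/
import Mathlib

section
/- Let φ₁, φ₂ be nonzero polar polynomials of orders n₁, n₂ respectively, and suppose that φ₁ ≠ λ φ₂ for every λ ∈ ℝ_{>0}. Then for every open sector S = S(τ, ε, r) of amplitude 2ε > 2π / max{n₁, n₂, 2}, at least one of the following holds: (a) there exists a nonempty bounded open set U ⊆ S such that Re φ₁ is bounded above on U and Re φ₂ is not bounded above on U; (b) there exists a nonempty bounded open set V ⊆ S such that Re φ₂ is bounded above on V and Re φ₁ is not bounded above on V. -/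
open scoped Real

/-- The polar polynomial `z ↦ ∑_{j=1}^n a j * z^(-j)` on `ℂ` (with the usual
convention `0 ^ (-j) = 0`). -/
noncomputable def polarPoly (n : ℕ) (a : ℕ → ℂ) (z : ℂ) : ℂ :=
  ∑ j ∈ Finset.Icc 1 n, a j * z ^ (-(j : ℤ))

/-- The open sector centered at `τ` of amplitude `2ε` and radius `r`. -/
def sector (τ ε r : ℝ) : Set ℂ :=
  {z | ∃ ρ θ : ℝ, 0 < ρ ∧ ρ < r ∧ τ - ε < θ ∧ θ < τ + ε ∧
    z = ρ * Complex.exp (θ * Complex.I)}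

/-- The sector with parameters `τ, ε` contains the direction `θ₀` (mod `2π`). -/
def sectorContains (τ ε θ₀ : ℝ) : Prop :=
  ∃ θ : ℝ, τ - ε < θ ∧ θ < τ + ε ∧ ∃ k : ℤ, θ₀ = θ + 2 * π * k

/-- A set `U ⊆ ℂ` is concentrated along the direction `θ₀`: it is nonempty,
connected, bounded, has `0` on its boundary, and near `0` it is contained in
any open sector containing `θ₀`. -/
def ConcentratedAlong (U : Set ℂ) (θ₀ : ℝ) : Prop :=
  U.Nonempty ∧ IsConnected U ∧ Bornology.IsBounded U ∧ (0 : ℂ) ∈ frontier U ∧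
    ∀ τ ε r : ℝ, 0 < ε → ε ≤ π → 0 < r → sectorContains τ ε θ₀ →
      ∃ W : Set ℂ, IsOpen W ∧ (0 : ℂ) ∈ W ∧ U ∩ W ⊆ sector τ ε r

/-- The set `U_{φ,A} = {z ∈ ℂ∖{0} : Re φ(z) < A}`. -/
def Uset (φ : ℂ → ℂ) (A : ℝ) : Set ℂ :=
  {z | z ≠ 0 ∧ (φ z).re < A}

open Filter Topology

/-- The point of `ℂ` with polar coordinates `(ρ, θ)`. -/
noncomputable def polarPoint (ρ θ : ℝ) : ℂ :=
  ρ * Complex.exp (θ * Complex.I)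

/-- The coefficient of `ρ ^ (-n)` in `c * z ^ (-n)` along the ray of direction `θ`. -/
noncomputable def dirCoeff (n : ℕ) (c : ℂ) (θ : ℝ) : ℂ :=
  c * Complex.exp (-(n * θ) * Complex.I)

/-- Some nonempty bounded open subset of `S` has `Re φ` bounded above but `Re χ` not. -/
def SeparatedOn (S : Set ℂ) (φ χ : ℂ → ℂ) : Prop :=
  ∃ U : Set ℂ, U.Nonempty ∧ IsOpen U ∧ Bornology.IsBounded U ∧ U ⊆ S ∧
    (∃ B : ℝ, ∀ z ∈ U, (φ z).re ≤ B) ∧ ¬ (∃ B : ℝ, ∀ z ∈ U, (χ z).re ≤ B)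

lemma dirCoeff_add (n : ℕ) (c : ℂ) (θ t : ℝ) :
    dirCoeff n c (θ + t) = dirCoeff n c θ * Complex.exp ((-(n * t) : ℝ) * Complex.I) := by
  rw [dirCoeff, dirCoeff, mul_assoc, ← Complex.exp_add]
  push_cast
  ring_nf

lemma dirCoeff_add_re (n : ℕ) (c : ℂ) (θ t : ℝ) :
    (dirCoeff n c (θ + t)).re =
      (dirCoeff n c θ).re * Real.cos (n * t) + (dirCoeff n c θ).im * Real.sin (n * t) := by
  rw [dirCoeff_add, Complex.mul_re, Complex.exp_ofReal_mul_I_re, Complex.exp_ofReal_mul_I_im,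
    Real.cos_neg, Real.sin_neg]
  ring

lemma dirCoeff_ne_zero (n : ℕ) {c : ℂ} (hc : c ≠ 0) (θ : ℝ) : dirCoeff n c θ ≠ 0 :=
  mul_ne_zero hc (Complex.exp_ne_zero _)

lemma dirCoeff_im_ne_zero {n : ℕ} {c : ℂ} (hc : c ≠ 0) {θ : ℝ}
    (h : (dirCoeff n c θ).re = 0) : (dirCoeff n c θ).im ≠ 0 :=
  fun h' => dirCoeff_ne_zero n hc θ (Complex.ext h h')

lemma continuous_dirCoeff (n : ℕ) (c : ℂ) : Continuous (dirCoeff n c) := by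
  unfold dirCoeff
  fun_prop

lemma dirCoeff_neg (n : ℕ) (c : ℂ) (θ : ℝ) : dirCoeff n (-c) θ = -dirCoeff n c θ := by
  simp [dirCoeff]

lemma polarPoly_neg (n : ℕ) (a : ℕ → ℂ) (z : ℂ) : polarPoly n (-a) z = -polarPoly n a z := by
  simp [polarPoly]

lemma polarPoint_ne_zero {ρ : ℝ} (hρ : 0 < ρ) (θ : ℝ) : polarPoint ρ θ ≠ 0 :=
  mul_ne_zero (by exact_mod_cast hρ.ne') (Complex.exp_ne_zero _)

lemma continuousOn_polarPoly (n : ℕ) (a : ℕ → ℂ) : ContinuousOn (polarPoly n a) {z | z ≠ 0} := by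
  unfold polarPoly
  refine continuousOn_finsetSum _ fun j _ => continuousOn_const.mul ?_
  exact fun z hz => (continuousAt_zpow₀ z _ (Or.inl hz)).continuousWithinAt

lemma polarPoly_polarPoint (n : ℕ) (a : ℕ → ℂ) {ρ : ℝ} (hρ : 0 < ρ) (θ : ℝ) :
    polarPoly n a (polarPoint ρ θ) =
      ((ρ⁻¹ ^ n : ℝ) : ℂ) * ∑ j ∈ Finset.Icc 1 n, (ρ : ℂ) ^ (n - j) * dirCoeff j (a j) θ := by
  rw [polarPoly, Finset.mul_sum]
  refine Finset.sum_congr rfl fun j hj => ?_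
  have hρ' : (ρ : ℂ) ≠ 0 := by exact_mod_cast hρ.ne'
  have hpow : (ρ : ℂ) ^ n = ρ ^ (n - j) * ρ ^ j := by
    rw [← pow_add, Nat.sub_add_cancel (Finset.mem_Icc.mp hj).2]
  have hexp : Complex.exp (θ * Complex.I) ^ (-(j : ℤ)) =
      Complex.exp (-(j * θ) * Complex.I) := by
    rw [← Complex.exp_int_mul]
    push_cast
    ring_nf
  rw [polarPoint, mul_zpow, hexp, zpow_neg, zpow_natCast, dirCoeff]
  push_cast
  rw [inv_pow, hpow]
  field_simp

lemma tendsto_re_polarPoly_atTop {n : ℕ} (hn : 0 < n) (a : ℕ → ℂ) {θ₀ : ℝ}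
    (h : 0 < (dirCoeff n (a n) θ₀).re) :
    Tendsto (fun p : ℝ × ℝ => (polarPoly n a (polarPoint p.1 p.2)).re)
      (𝓝[>] 0 ×ˢ 𝓝 θ₀) atTop := by
  have hpow : Tendsto (fun p : ℝ × ℝ => p.1⁻¹ ^ n) (𝓝[>] 0 ×ˢ 𝓝 θ₀) atTop :=
    (tendsto_pow_atTop hn.ne').comp (tendsto_inv_nhdsGT_zero.comp tendsto_fst)
  have hcont : Continuous fun p : ℝ × ℝ =>
      (∑ j ∈ Finset.Icc 1 n, (p.1 : ℂ) ^ (n - j) * dirCoeff j (a j) p.2).re := by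
    refine Complex.continuous_re.comp (continuous_finsetSum _ fun j _ => ?_)
    exact (by fun_prop : Continuous fun p : ℝ × ℝ => (p.1 : ℂ) ^ (n - j)).mul
      ((continuous_dirCoeff j (a j)).comp continuous_snd)
  have hlim := (hcont.tendsto (0, θ₀)).mono_left
    (show 𝓝[>] 0 ×ˢ 𝓝 θ₀ ≤ 𝓝 ((0 : ℝ), θ₀) by
      rw [nhds_prod_eq]; exact prod_mono_left _ nhdsWithin_le_nhds)
  have hval : (∑ j ∈ Finset.Icc 1 n, ((0 : ℝ) : ℂ) ^ (n - j) * dirCoeff j (a j) θ₀) =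
      dirCoeff n (a n) θ₀ := by
    rw [Finset.sum_eq_single_of_mem n (Finset.mem_Icc.mpr ⟨hn, le_rfl⟩)]
    · simp
    · intro j hj hjn
      have := (Finset.mem_Icc.mp hj).2
      simp [show n - j ≠ 0 by omega]
  simp only [hval] at hlim
  refine (hpow.atTop_mul_pos h hlim).congr' ?_
  filter_upwards [tendsto_fst.eventually (self_mem_nhdsWithin (a := (0 : ℝ)) (s := Set.Ioi 0))]
    with p hp
  rw [polarPoly_polarPoint n a hp, Complex.re_ofReal_mul]

lemma tendsto_re_polarPoly_atBot {n : ℕ} (hn : 0 < n) (a : ℕ → ℂ) {θ₀ : ℝ}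
    (h : (dirCoeff n (a n) θ₀).re < 0) :
    Tendsto (fun p : ℝ × ℝ => (polarPoly n a (polarPoint p.1 p.2)).re)
      (𝓝[>] 0 ×ˢ 𝓝 θ₀) atBot := by
  have := tendsto_re_polarPoly_atTop hn (-a) (θ₀ := θ₀) (by simpa [dirCoeff_neg] using h)
  simpa [polarPoly_neg, Function.comp_def] using tendsto_neg_atTop_atBot.comp this

lemma exists_dirCoeff_re_neg_pos {n : ℕ} (hn : 0 < n) {c : ℂ} (hc : c ≠ 0) {θ₀ : ℝ}
    (h : (dirCoeff n c θ₀).re = 0) {δ : ℝ} (hδ : 0 < δ) :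
    ∃ θ₁ ∈ Metric.ball θ₀ δ, ∃ θ₂ ∈ Metric.ball θ₀ δ,
      (dirCoeff n c θ₁).re < 0 ∧ 0 < (dirCoeff n c θ₂).re := by
  have hn' : (0 : ℝ) < n := by exact_mod_cast hn
  obtain ⟨t, ht, htlt⟩ := exists_between (lt_min hδ (div_pos Real.pi_pos hn'))
  have htδ : t < δ := htlt.trans_le (min_le_left _ _)
  have htn : n * t < π := by
    rw [mul_comm]
    exact (lt_div_iff₀ hn').mp (htlt.trans_le (min_le_right _ _))
  have hsin : 0 < Real.sin (n * t) := Real.sin_pos_of_pos_of_lt_pi (by positivity) htn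
  have hplus : (dirCoeff n c (θ₀ + t)).re = (dirCoeff n c θ₀).im * Real.sin (n * t) := by
    rw [dirCoeff_add_re, h]; ring
  have hminus : (dirCoeff n c (θ₀ + -t)).re = -((dirCoeff n c θ₀).im * Real.sin (n * t)) := by
    rw [dirCoeff_add_re, h, mul_neg, Real.sin_neg]; ring
  have hbplus : θ₀ + t ∈ Metric.ball θ₀ δ := by simpa [Real.dist_eq, abs_of_pos ht] using htδ
  have hbminus : θ₀ + -t ∈ Metric.ball θ₀ δ := by simpa [Real.dist_eq, abs_of_pos ht] using htδ
  rcases lt_or_gt_of_ne (dirCoeff_im_ne_zero hc h) with him | him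
  · have := mul_neg_of_neg_of_pos him hsin
    exact ⟨_, hbplus, _, hbminus, by linarith, by linarith⟩
  · have := mul_pos him hsin
    exact ⟨_, hbminus, _, hbplus, by linarith, by linarith⟩

/-- Near a direction where the leading term is purely imaginary, `Re φ` takes every value. -/
lemma frequently_re_polarPoly_eq {n : ℕ} (hn : 0 < n) {a : ℕ → ℂ} (ha : a n ≠ 0) {θ₀ : ℝ}
    (h : (dirCoeff n (a n) θ₀).re = 0) (M : ℝ) :
    ∃ᶠ p : ℝ × ℝ in 𝓝[>] 0 ×ˢ 𝓝 θ₀, (polarPoly n a (polarPoint p.1 p.2)).re = M := by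
  rw [frequently_iff]
  intro s hs
  obtain ⟨t₁, ht₁, t₂, ht₂, hsub⟩ := mem_prod_iff.mp hs
  obtain ⟨δ, hδ, hball⟩ := Metric.mem_nhds_iff.mp ht₂
  obtain ⟨θ₁, hθ₁, θ₂, hθ₂, hneg, hpos⟩ := exists_dirCoeff_re_neg_pos hn ha h hδ
  have hray : ∀ θ : ℝ, Tendsto (fun ρ : ℝ => (ρ, θ)) (𝓝[>] 0) (𝓝[>] 0 ×ˢ 𝓝 θ) := fun θ =>
    tendsto_id.prodMk tendsto_const_nhds
  obtain ⟨ρ, hle, hge, hρt, hρ⟩ :=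
    ((((tendsto_re_polarPoly_atBot hn a hneg).comp (hray θ₁)).eventually_le_atBot M).and
      ((((tendsto_re_polarPoly_atTop hn a hpos).comp (hray θ₂)).eventually_ge_atTop M).and
        ((show ∀ᶠ ρ in 𝓝[>] (0 : ℝ), ρ ∈ t₁ from ht₁).and
          (self_mem_nhdsWithin (a := (0 : ℝ)) (s := Set.Ioi 0))))).exists
  have hcont : ContinuousOn (fun θ : ℝ => (polarPoly n a (polarPoint ρ θ)).re)
      (Metric.ball θ₀ δ) := by
    refine Complex.continuous_re.comp_continuousOn ((continuousOn_polarPoly n a).comp ?_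
      fun θ _ => polarPoint_ne_zero hρ θ)
    unfold polarPoint
    fun_prop
  obtain ⟨θ, hθ, hθM⟩ := (convex_ball θ₀ δ).isPreconnected.intermediate_value hθ₁ hθ₂ hcont
    ⟨hle, hge⟩
  exact ⟨(ρ, θ), hsub ⟨hρt, hball hθ⟩, hθM⟩

lemma sector_eq_image_exp {r : ℝ} (hr : 0 < r) (τ ε : ℝ) :
    sector τ ε r =
      Complex.exp '' {w | w.re < Real.log r ∧ τ - ε < w.im ∧ w.im < τ + ε} := by
  ext z
  constructor
  · rintro ⟨ρ, θ, hρ, hρr, h₁, h₂, rfl⟩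
    refine ⟨Real.log ρ + θ * Complex.I, ⟨?_, ?_, ?_⟩, ?_⟩
    · simpa using Real.log_lt_log hρ hρr
    · simpa using h₁
    · simpa using h₂
    · rw [Complex.exp_add, ← Complex.ofReal_exp, Real.exp_log hρ]
  · rintro ⟨w, ⟨h₁, h₂, h₃⟩, rfl⟩
    refine ⟨Real.exp w.re, w.im, Real.exp_pos _, (Real.lt_log_iff_exp_lt hr).mp h₁, h₂, h₃, ?_⟩
    rw [Complex.ofReal_exp, ← Complex.exp_add, Complex.re_add_im]

lemma isOpen_sector {r : ℝ} (hr : 0 < r) (τ ε : ℝ) : IsOpen (sector τ ε r) := by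
  rw [sector_eq_image_exp hr]
  refine Complex.isOpenMap_exp _ ?_
  exact (isOpen_lt Complex.continuous_re continuous_const).inter
    ((isOpen_lt continuous_const Complex.continuous_im).inter
      (isOpen_lt Complex.continuous_im continuous_const))

lemma isBounded_sector (τ ε r : ℝ) : Bornology.IsBounded (sector τ ε r) := by
  refine Metric.isBounded_ball (x := (0 : ℂ)) (r := r) |>.subset ?_
  rintro _ ⟨ρ, θ, hρ, hρr, -, -, rfl⟩
  simpa [Complex.norm_exp_ofReal_mul_I, abs_of_pos hρ] using hρr

lemma sector_subset_ne_zero (τ ε r : ℝ) : sector τ ε r ⊆ {z | z ≠ 0} := by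
  rintro _ ⟨ρ, θ, hρ, -, -, -, rfl⟩
  exact polarPoint_ne_zero hρ θ

lemma eventually_polarPoint_mem_sector {τ ε r θ₀ : ℝ} (hr : 0 < r)
    (hθ₀ : θ₀ ∈ Set.Ioo (τ - ε) (τ + ε)) :
    ∀ᶠ p : ℝ × ℝ in 𝓝[>] 0 ×ˢ 𝓝 θ₀, polarPoint p.1 p.2 ∈ sector τ ε r := by
  filter_upwards [prod_mem_prod (Ioo_mem_nhdsGT hr) (isOpen_Ioo.mem_nhds hθ₀)] with p hp
  exact ⟨p.1, p.2, hp.1.1, hp.1.2, hp.2.1, hp.2.2, rfl⟩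

lemma separatedOn_of_frequently {τ ε r θ₀ : ℝ} (hr : 0 < r)
    (hθ₀ : θ₀ ∈ Set.Ioo (τ - ε) (τ + ε)) {φ χ : ℂ → ℂ} (hφ : ContinuousOn φ {z | z ≠ 0})
    (B : ℝ) (h : ∀ M : ℝ, ∃ᶠ p : ℝ × ℝ in 𝓝[>] 0 ×ˢ 𝓝 θ₀,
      (φ (polarPoint p.1 p.2)).re < B ∧ M < (χ (polarPoint p.1 p.2)).re) :
    SeparatedOn (sector τ ε r) φ χ := by
  have hex : ∀ M : ℝ, ∃ z ∈ sector τ ε r ∩ {z | (φ z).re < B}, M < (χ z).re := fun M => by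
    obtain ⟨p, ⟨hB, hM⟩, hp⟩ :=
      ((h M).and_eventually (eventually_polarPoint_mem_sector hr hθ₀)).exists
    exact ⟨_, ⟨hp, hB⟩, hM⟩
  refine ⟨sector τ ε r ∩ {z | (φ z).re < B}, ?_, ?_, ?_, Set.inter_subset_left,
    ⟨B, fun z hz => hz.2.le⟩, ?_⟩
  · obtain ⟨z, hz, -⟩ := hex 0
    exact ⟨z, hz⟩
  · exact (Complex.continuous_re.comp_continuousOn
      (hφ.mono (sector_subset_ne_zero τ ε r))).isOpen_inter_preimage (isOpen_sector hr τ ε)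
      isOpen_Iio
  · exact (isBounded_sector τ ε r).subset Set.inter_subset_left
  · rintro ⟨C, hC⟩
    obtain ⟨z, hz, hlt⟩ := hex C
    exact (hC z hz).not_gt hlt

/-- If `φ₂ = l φ₁ + ψ` with `l` real and no separating set exists, the leading terms of `φ₁` and
`ψ` are purely imaginary on common rays. -/
lemma dirCoeff_re_eq_zero_of_not_separatedOn {τ ε r θ₀ : ℝ} (hr : 0 < r)
    (hθ₀ : θ₀ ∈ Set.Ioo (τ - ε) (τ + ε)) {n₁ n₂ m : ℕ} {a₁ a₂ c : ℕ → ℂ} (hn₁ : 0 < n₁)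
    (hm : 0 < m) (ha₁ : a₁ n₁ ≠ 0) {l : ℝ}
    (heq : ∀ z, polarPoly n₂ a₂ z = l * polarPoly n₁ a₁ z + polarPoly m c z)
    (hnot₁ : ¬ SeparatedOn (sector τ ε r) (polarPoly n₁ a₁) (polarPoly n₂ a₂))
    (hnot₂ : ¬ SeparatedOn (sector τ ε r) (polarPoly n₂ a₂) (polarPoly n₁ a₁))
    (h : (dirCoeff n₁ (a₁ n₁) θ₀).re = 0) : (dirCoeff m (c m) θ₀).re = 0 := by
  have hre : ∀ z, (polarPoly n₂ a₂ z).re = l * (polarPoly n₁ a₁ z).re + (polarPoly m c z).re :=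
    fun z => by rw [heq, Complex.add_re, Complex.re_ofReal_mul]
  rcases lt_trichotomy (dirCoeff m (c m) θ₀).re 0 with hneg | hzero | hpos
  · refine absurd (separatedOn_of_frequently hr hθ₀ (continuousOn_polarPoly _ _) 0 fun M => ?_)
      hnot₂
    refine ((frequently_re_polarPoly_eq hn₁ ha₁ h (M + 1)).and_eventually
      ((tendsto_re_polarPoly_atBot hm c hneg).eventually_lt_atBot (-(l * (M + 1))))).mono ?_
    rintro p ⟨hp₁, hp₂⟩
    rw [hre, hp₁]
    constructor <;> linarith
  · exact hzero
  · refine absurd (separatedOn_of_frequently hr hθ₀ (continuousOn_polarPoly _ _) 1 fun M => ?_)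
      hnot₁
    refine ((frequently_re_polarPoly_eq hn₁ ha₁ h 0).and_eventually
      ((tendsto_re_polarPoly_atTop hm c hpos).eventually_gt_atTop M)).mono ?_
    rintro p ⟨hp₁, hp₂⟩
    rw [hre, hp₁]
    constructor <;> linarith

lemma separatedOn_of_dirCoeff_neg_pos {τ ε r θ₀ : ℝ} (hr : 0 < r)
    (hθ₀ : θ₀ ∈ Set.Ioo (τ - ε) (τ + ε)) {n₁ n₂ : ℕ} {a₁ a₂ : ℕ → ℂ} (hn₁ : 0 < n₁)
    (hn₂ : 0 < n₂) (h₁ : (dirCoeff n₁ (a₁ n₁) θ₀).re < 0)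
    (h₂ : 0 < (dirCoeff n₂ (a₂ n₂) θ₀).re) :
    SeparatedOn (sector τ ε r) (polarPoly n₁ a₁) (polarPoly n₂ a₂) :=
  separatedOn_of_frequently hr hθ₀ (continuousOn_polarPoly _ _) 0 fun M =>
    (((tendsto_re_polarPoly_atBot hn₁ a₁ h₁).eventually_lt_atBot 0).and
      ((tendsto_re_polarPoly_atTop hn₂ a₂ h₂).eventually_gt_atTop M)).frequently

lemma exists_dirCoeff_re_eq_zero {n : ℕ} (hn : 0 < n) (c : ℂ) (b : ℝ) :
    ∃ θ ∈ Set.Ioc b (b + π / n), (dirCoeff n c θ).re = 0 := by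
  have hn' : (0 : ℝ) < n := by exact_mod_cast hn
  obtain ⟨k, hk, -⟩ := existsUnique_add_zsmul_mem_Ioc (div_pos Real.pi_pos hn')
    ((Complex.arg c + π / 2) / n) b
  refine ⟨_, hk, ?_⟩
  set θ : ℝ := (Complex.arg c + π / 2) / n + k • (π / n) with hθ
  have hangle : Complex.arg c - n * θ = -(π / 2) - k * π := by
    rw [hθ, zsmul_eq_mul]
    field_simp
    ring
  have hpolar : dirCoeff n c θ = ‖c‖ * Complex.exp ((Complex.arg c - n * θ : ℝ) * Complex.I) := by
    conv_lhs => rw [dirCoeff, ← Complex.norm_mul_exp_arg_mul_I c]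
    rw [mul_assoc, ← Complex.exp_add]
    push_cast
    ring_nf
  rw [hpolar, Complex.re_ofReal_mul, Complex.exp_ofReal_mul_I_re, hangle,
    Real.cos_sub_int_mul_pi]
  simp

lemma dirCoeff_add_pi_div_re {n : ℕ} (hn : 0 < n) (c : ℂ) (θ : ℝ) :
    (dirCoeff n c (θ + π / n)).re = -(dirCoeff n c θ).re := by
  have hn' : (n : ℝ) ≠ 0 := by exact_mod_cast hn.ne'
  rw [dirCoeff_add_re, mul_div_cancel₀ _ hn']
  simp

/-- Terms of lower order are not purely imaginary on two rays at angle `π / n`. -/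
lemma dirCoeff_add_pi_div_re_ne_zero {m n : ℕ} (hm : 0 < m) (hmn : m < n) {c : ℂ} (hc : c ≠ 0)
    {θ : ℝ} (h : (dirCoeff m c θ).re = 0) : (dirCoeff m c (θ + π / n)).re ≠ 0 := by
  have hm' : (0 : ℝ) < m := by exact_mod_cast hm
  have hmn' : (m : ℝ) < n := by exact_mod_cast hmn
  have hn' : (0 : ℝ) < n := hm'.trans hmn'
  rw [dirCoeff_add_re, h, zero_mul, zero_add]
  refine mul_ne_zero (dirCoeff_im_ne_zero hc h) (Real.sin_pos_of_pos_of_lt_pi ?_ ?_).ne'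
  · exact mul_pos hm' (div_pos Real.pi_pos hn')
  · rw [← mul_div_assoc, div_lt_iff₀ hn', mul_comm]
    exact mul_lt_mul_of_pos_left hmn' Real.pi_pos

/-- Every polar polynomial vanishes identically or has an order. -/
lemma polarPoly_eq_zero_or_exists_order (n : ℕ) (c : ℕ → ℂ) :
    (∀ z, polarPoly n c z = 0) ∨
      ∃ m, 0 < m ∧ m ≤ n ∧ c m ≠ 0 ∧ ∀ z, polarPoly n c z = polarPoly m c z := by
  induction n with
  | zero => exact Or.inl fun z => by simp [polarPoly]
  | succ n ih =>
    by_cases hc : c (n + 1) = 0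
    · have hstep : ∀ z, polarPoly (n + 1) c z = polarPoly n c z := fun z => by
        rw [polarPoly, Finset.sum_Icc_succ_top (by omega), hc, zero_mul, add_zero, polarPoly]
      simp only [hstep]
      exact ih.imp_right fun ⟨m, hm, hmn, h⟩ => ⟨m, hm, by omega, h⟩
    · exact Or.inr ⟨n + 1, by omega, le_rfl, hc, fun _ => rfl⟩

lemma exists_real_eq_mul_of_dirCoeff {n : ℕ} {c d : ℂ} (hc : c ≠ 0) (hd : d ≠ 0) {θ : ℝ}
    (h₁ : (dirCoeff n c θ).re = 0) (h₂ : (dirCoeff n d θ).re = 0) :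
    ∃ l : ℝ, l ≠ 0 ∧ d = l * c := by
  have hi₁ := dirCoeff_im_ne_zero hc h₁
  have hi₂ := dirCoeff_im_ne_zero hd h₂
  refine ⟨(dirCoeff n d θ).im / (dirCoeff n c θ).im, div_ne_zero hi₂ hi₁, ?_⟩
  have hdir : dirCoeff n d θ =
      ((dirCoeff n d θ).im / (dirCoeff n c θ).im : ℝ) * dirCoeff n c θ := by
    apply Complex.ext
    · rw [Complex.re_ofReal_mul, h₁, h₂, mul_zero]
    · rw [Complex.im_ofReal_mul, div_mul_cancel₀ _ hi₁]
  refine mul_right_cancel₀ (Complex.exp_ne_zero (-(n * θ) * Complex.I)) ?_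
  rw [mul_assoc]
  exact hdir

lemma separatedOn_or_separatedOn_of_le {n₁ n₂ : ℕ} (hn₂ : 0 < n₂) (hle : n₂ ≤ n₁)
    {a₁ a₂ : ℕ → ℂ} (ha₁ : a₁ n₁ ≠ 0) (ha₂ : a₂ n₂ ≠ 0)
    (hprop : ¬ ∃ l : ℝ, 0 < l ∧ ∀ z, polarPoly n₂ a₂ z = l * polarPoly n₁ a₁ z)
    {τ ε r : ℝ} (hr : 0 < r) (hε : π / max (n₁ : ℝ) 2 < ε) :
    SeparatedOn (sector τ ε r) (polarPoly n₁ a₁) (polarPoly n₂ a₂) ∨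
      SeparatedOn (sector τ ε r) (polarPoly n₂ a₂) (polarPoly n₁ a₁) := by
  by_contra! hnot
  obtain ⟨hnot₁, hnot₂⟩ := hnot
  have hn₁ : 0 < n₁ := hn₂.trans_le hle
  have hn₁' : (1 : ℝ) ≤ n₁ := by exact_mod_cast hn₁
  have hstep : π / n₁ < 2 * ε := by
    have : π / n₁ ≤ 2 * (π / max (n₁ : ℝ) 2) := by
      rw [← mul_div_assoc, div_le_div_iff₀ (by positivity) (by positivity)]
      have : max (n₁ : ℝ) 2 ≤ 2 * n₁ := max_le (by linarith) (by linarith)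
      nlinarith [Real.pi_pos]
    linarith
  obtain ⟨θ₀, hθ₀, hzero⟩ := exists_dirCoeff_re_eq_zero hn₁ (a₁ n₁) (τ - ε)
  have hmem : θ₀ ∈ Set.Ioo (τ - ε) (τ + ε) := ⟨hθ₀.1, by linarith [hθ₀.2]⟩
  have hlower : ∀ (l : ℝ) (m : ℕ) (c : ℕ → ℂ), 0 < m → m < n₁ → c m ≠ 0 →
      (∀ z, polarPoly n₂ a₂ z = l * polarPoly n₁ a₁ z + polarPoly m c z) → False := by
    intro l m c hm hmn hc heq
    have htwo_le : (2 : ℝ) ≤ n₁ := by exact_mod_cast (show 2 ≤ n₁ by omega)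
    rw [max_eq_left htwo_le] at hε
    have hmem' : θ₀ + π / n₁ ∈ Set.Ioo (τ - ε) (τ + ε) :=
      ⟨by linarith [hθ₀.1, show 0 < π / n₁ by positivity], by linarith [hθ₀.2]⟩
    refine dirCoeff_add_pi_div_re_ne_zero hm hmn hc
      (dirCoeff_re_eq_zero_of_not_separatedOn hr hmem hn₁ hm ha₁ heq hnot₁ hnot₂ hzero)
      (dirCoeff_re_eq_zero_of_not_separatedOn hr hmem' hn₁ hm ha₁ heq hnot₁ hnot₂ ?_)
    rw [dirCoeff_add_pi_div_re hn₁, hzero, neg_zero]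
  have hself : ∀ z, polarPoly n₂ a₂ z = (0 : ℝ) * polarPoly n₁ a₁ z + polarPoly n₂ a₂ z :=
    fun z => by simp
  obtain rfl : n₂ = n₁ := hle.eq_of_not_lt fun hlt => hlower 0 n₂ a₂ hn₂ hlt ha₂ hself
  obtain ⟨l, hl0, hl⟩ := exists_real_eq_mul_of_dirCoeff ha₁ ha₂ hzero
    (dirCoeff_re_eq_zero_of_not_separatedOn hr hmem hn₂ hn₂ ha₁ hself hnot₁ hnot₂ hzero)
  have hlpos : 0 < l := by
    refine hl0.lt_or_gt.resolve_left fun hneg => ?_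
    obtain ⟨δ, hδ, hball⟩ := Metric.mem_nhds_iff.mp (isOpen_Ioo.mem_nhds hmem)
    obtain ⟨θ, hθ, -, -, hθneg, -⟩ := exists_dirCoeff_re_neg_pos hn₂ ha₁ hzero hδ
    refine hnot₁ (separatedOn_of_dirCoeff_neg_pos hr (hball hθ) hn₂ hn₂ hθneg ?_)
    rw [hl, dirCoeff, mul_assoc, Complex.re_ofReal_mul]
    exact mul_pos_of_neg_of_neg hneg hθneg
  have hdecomp : ∀ z, polarPoly n₂ a₂ z =
      l * polarPoly n₂ a₁ z + polarPoly n₂ (fun j => a₂ j - l * a₁ j) z := fun z => by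
    simp only [polarPoly, Finset.mul_sum, ← Finset.sum_add_distrib]
    exact Finset.sum_congr rfl fun j _ => by ring
  rcases polarPoly_eq_zero_or_exists_order n₂ (fun j => a₂ j - l * a₁ j) with
    hvanish | ⟨m, hm, hmn, hcm, heq⟩
  · exact hprop ⟨l, hlpos, fun z => by rw [hdecomp, hvanish, add_zero]⟩
  · refine hlower l m _ hm (hmn.lt_of_ne ?_) hcm fun z => by rw [hdecomp, heq]
    rintro rfl
    exact hcm (by simp [hl])

/-- Let `φ₁, φ₂` be nonzero polar polynomials of orders `n₁, n₂`,
not positive real multiples of each other.  Then on every open sector of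
amplitude `> 2π / max{n₁, n₂, 2}`, one of the two "separating" open sets
exists: a nonempty bounded open subset on which one of `Re φ₁, Re φ₂` is
bounded above and the other is not. -/
theorem exists_separating_set_in_sector
    (n₁ n₂ : ℕ) (hn₁ : 0 < n₁) (hn₂ : 0 < n₂)
    (a₁ a₂ : ℕ → ℂ) (ha₁ : a₁ n₁ ≠ 0) (ha₂ : a₂ n₂ ≠ 0)
    (hprop : ¬ ∃ lam : ℝ, 0 < lam ∧
      ∀ z : ℂ, z ≠ 0 → polarPoly n₁ a₁ z = (lam : ℂ) * polarPoly n₂ a₂ z)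
    (τ ε r : ℝ) (hr : 0 < r)
    (hε₁ : π / max (max (n₁ : ℝ) (n₂ : ℝ)) 2 < ε) (hε₂ : ε ≤ π) :
    (∃ U : Set ℂ, U.Nonempty ∧ IsOpen U ∧ Bornology.IsBounded U ∧
        U ⊆ sector τ ε r ∧
        (∃ B : ℝ, ∀ z ∈ U, (polarPoly n₁ a₁ z).re ≤ B) ∧
        ¬ (∃ B : ℝ, ∀ z ∈ U, (polarPoly n₂ a₂ z).re ≤ B))
      ∨
    (∃ V : Set ℂ, V.Nonempty ∧ IsOpen V ∧ Bornology.IsBounded V ∧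
        V ⊆ sector τ ε r ∧
        (∃ B : ℝ, ∀ z ∈ V, (polarPoly n₂ a₂ z).re ≤ B) ∧
        ¬ (∃ B : ℝ, ∀ z ∈ V, (polarPoly n₁ a₁ z).re ≤ B)) := by
  change SeparatedOn _ (polarPoly n₁ a₁) (polarPoly n₂ a₂) ∨
    SeparatedOn _ (polarPoly n₂ a₂) (polarPoly n₁ a₁)
  rcases le_total n₂ n₁ with hle | hle
  · rw [max_eq_left (by exact_mod_cast hle : (n₂ : ℝ) ≤ n₁)] at hε₁
    refine separatedOn_or_separatedOn_of_le hn₂ hle ha₁ ha₂ ?_ hr hε₁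
    rintro ⟨l, hl, h⟩
    refine hprop ⟨l⁻¹, inv_pos.mpr hl, fun z _ => ?_⟩
    rw [h, Complex.ofReal_inv, inv_mul_cancel_left₀ (by exact_mod_cast hl.ne')]
  · rw [max_eq_right (by exact_mod_cast hle : (n₁ : ℝ) ≤ n₂)] at hε₁
    refine (separatedOn_or_separatedOn_of_le hn₁ hle ha₂ ha₁ ?_ hr hε₁).symm
    exact fun ⟨l, hl, h⟩ => hprop ⟨l, hl, fun z _ => h z⟩
end

section
/- Let l ∈ ℤ_{>0}, let φ₁, φ₂ be polar polynomials of orders n₁, n₂ respectively, and let ω be a polar polynomial of order m with m > n_j/l + 1 for j = 1, 2. Let S := {ρ e^{iθ} : 0 < ρ < r, τ₀ < θ < τ₀ + 2π} for some r > 0, τ₀ ∈ ℝ (an open sector of amplitude 2π), and let ζ : S → ℂ be a holomorphic function with ζ(z)^l = z for every z ∈ S. Then the following are equivalent: (i) the functions φ₁ ∘ ζ and φ₂ ∘ ζ are not equal on S; (ii) at least one of the following holds: (a) there exists a nonempty bounded open set U ⊆ S such that z ↦ Re(φ₁(ζ(z)) + ω(z)) is bounded above on U while z ↦ Re(φ₂(ζ(z))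 + ω(z)) is not bounded above on U; (b) there exists a nonempty bounded open set V ⊆ S such that z ↦ Re(φ₂(ζ(z)) + ω(z)) is bounded above on V while z ↦ Re(φ₁(ζ(z)) + ω(z)) is not bounded above on V. -/
open scoped Real

open Filter Topology Polynomial

theorem Complex.re_mul_exp_ofReal_mul_I (c : ℂ) (t : ℝ) :
    (c * Complex.exp (t * Complex.I)).re = ‖c‖ * Real.cos (c.arg + t) := by
  conv_lhs => rw [← Complex.norm_mul_exp_arg_mul_I c]
  rw [mul_assoc, ← Complex.exp_add, ← add_mul, ← Complex.ofReal_add, Complex.re_ofReal_mul,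
    Complex.exp_ofReal_mul_I_re]

/-- On large circles the real part of a polynomial is close to that of its leading term. -/
theorem Polynomial.eventually_abs_re_eval_sub_le (P : ℂ[X]) {ε : ℝ} (hε : 0 < ε) :
    ∀ᶠ x : ℝ in atTop, ∀ ψ : ℝ,
      |(P.eval (x * Complex.exp (ψ * Complex.I))).re
        - x ^ P.natDegree *
          (‖P.leadingCoeff‖ * Real.cos (P.leadingCoeff.arg + P.natDegree * ψ))|
        ≤ ε * x ^ P.natDegree := by
  have hc : ContinuousAt (fun v => P.reverse.eval v) 0 := P.reverse.continuous.continuousAt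
  obtain ⟨δ, hδ, h⟩ := Metric.continuousAt_iff.1 hc ε hε
  filter_upwards [eventually_gt_atTop 0, eventually_gt_atTop δ⁻¹] with x hx0 hx ψ
  set u : ℂ := x * Complex.exp (ψ * Complex.I) with hu
  have hnu : ‖u‖ = x := by
    rw [hu, norm_mul, Complex.norm_exp_ofReal_mul_I, mul_one, Complex.norm_real,
      Real.norm_of_nonneg hx0.le]
  have hu0 : u ≠ 0 := norm_pos_iff.1 (hnu ▸ hx0)
  have hd := h (x := u⁻¹) (by
    rw [dist_zero_right, norm_inv, hnu]
    exact inv_lt_of_inv_lt₀ hδ hx)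
  rw [← coeff_zero_eq_eval_zero, coeff_zero_reverse, dist_eq_norm] at hd
  have hrev : P.reverse.eval u⁻¹ * u ^ P.natDegree = P.eval u := by
    let _ := invertibleOfNonzero hu0
    simpa [eval₂_eq_eval_map] using eval₂_reverse_mul_pow (RingHom.id ℂ) u P
  have hlead : (P.leadingCoeff * u ^ P.natDegree).re = x ^ P.natDegree *
      (‖P.leadingCoeff‖ * Real.cos (P.leadingCoeff.arg + P.natDegree * ψ)) := by
    rw [hu, mul_pow, ← Complex.exp_nat_mul, ← Complex.ofReal_pow, mul_left_comm,
      Complex.re_ofReal_mul, ← Complex.re_mul_exp_ofReal_mul_I]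
    push_cast
    ring_nf
  rw [← hlead, ← hrev, ← Complex.sub_re, ← sub_mul]
  refine (Complex.abs_re_le_norm _).trans ?_
  rw [norm_mul, norm_pow, hnu]
  gcongr

/-- If the leading term of `P` is purely imaginary in the direction `ψ₀` and that of `G` has
positive real part there, then `re P` has zeros near that direction at which `re G` is
arbitrarily large. -/
theorem Polynomial.exists_re_eval_eq_zero_and_lt_re_eval {P G : ℂ[X]}
    (hP : 0 < P.natDegree) (hG : 0 < G.natDegree) {α β ψ₀ : ℝ} (hψ₀ : ψ₀ ∈ Set.Ioo α β)
    (hP₀ : Real.cos (P.leadingCoeff.arg + P.natDegree * ψ₀) = 0)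
    (hG₀ : 0 < Real.cos (G.leadingCoeff.arg + G.natDegree * ψ₀)) (M R : ℝ) :
    ∃ x > R, ∃ ψ ∈ Set.Ioo α β,
      (P.eval (x * Complex.exp (ψ * Complex.I))).re = 0 ∧
      M < (G.eval (x * Complex.exp (ψ * Complex.I))).re := by
  have hlc : ∀ {Q : ℂ[X]}, 0 < Q.natDegree → 0 < ‖Q.leadingCoeff‖ := fun {Q} hQ =>
    norm_pos_iff.2 (leadingCoeff_ne_zero.2 (ne_zero_of_natDegree_gt hQ))
  set D := P.natDegree
  set N := G.natDegree
  have hD : (0 : ℝ) < D := by exact_mod_cast hP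
  set h : ℝ → ℝ := fun ψ => ‖G.leadingCoeff‖ * Real.cos (G.leadingCoeff.arg + N * ψ) with hh
  have hpos : 0 < h ψ₀ := mul_pos (hlc hG) hG₀
  have hhc : Continuous h := by fun_prop
  have hev : ∀ᶠ ψ in 𝓝 ψ₀, ψ ∈ Set.Ioo α β ∧ h ψ₀ / 2 < h ψ :=
    (isOpen_Ioo.eventually_mem hψ₀).and
      (hhc.continuousAt.eventually (lt_mem_nhds (half_lt_self hpos)))
  obtain ⟨δ₀, hδ₀, hball⟩ := Metric.eventually_nhds_iff.1 hev
  obtain ⟨δ, hδ, hδlt⟩ := exists_between (lt_min hδ₀ (div_pos Real.pi_pos hD))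
  have hδ₁ : δ < δ₀ := hδlt.trans_le (min_le_left _ _)
  have hδ₂ : D * δ < π := by
    have := hδlt.trans_le (min_le_right _ _)
    rwa [lt_div_iff₀' hD] at this
  have hsin : 0 < Real.sin (D * δ) := Real.sin_pos_of_pos_of_lt_pi (by positivity) hδ₂
  set s : ℝ := ‖P.leadingCoeff‖ * (Real.sin (P.leadingCoeff.arg + D * ψ₀) * Real.sin (D * δ))
    with hs
  have hs0 : s ≠ 0 := by
    refine mul_ne_zero (hlc hP).ne' (mul_ne_zero (fun h0 => ?_) hsin.ne')
    simpa [h0, hP₀] using Real.sin_sq_add_cos_sq (P.leadingCoeff.arg + D * ψ₀)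
  have hplus : ‖P.leadingCoeff‖ * Real.cos (P.leadingCoeff.arg + D * (ψ₀ + δ)) = -s := by
    rw [mul_add, ← add_assoc, Real.cos_add, hP₀, hs]; ring
  have hminus : ‖P.leadingCoeff‖ * Real.cos (P.leadingCoeff.arg + D * (ψ₀ - δ)) = s := by
    rw [mul_sub, ← add_sub_assoc, Real.cos_sub, hP₀, hs]; ring
  have hlarge : ∀ᶠ x : ℝ in atTop, M < x ^ N * (h ψ₀ / 4) :=
    ((tendsto_pow_atTop hG.ne').atTop_mul_const (by positivity)).eventually_gt_atTop M
  obtain ⟨x, hxR, hx0, hxM, hxP, hxG⟩ := ((eventually_gt_atTop R).and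
    ((eventually_gt_atTop 0).and (hlarge.and
      ((P.eventually_abs_re_eval_sub_le (half_pos (abs_pos.2 hs0))).and
        (G.eventually_abs_re_eval_sub_le (ε := h ψ₀ / 4) (by positivity)))))).exists
  set f : ℝ → ℝ := fun ψ => (P.eval (x * Complex.exp (ψ * Complex.I))).re with hf
  have hfc : Continuous f := Complex.continuous_re.comp (P.continuous.comp (by fun_prop))
  have h₁ := abs_le.1 (hxP (ψ₀ + δ))
  have h₂ := abs_le.1 (hxP (ψ₀ - δ))
  rw [hplus] at h₁
  rw [hminus] at h₂
  have hxD : 0 < x ^ D := by positivity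
  have hzero : (0 : ℝ) ∈ Set.uIcc (f (ψ₀ - δ)) (f (ψ₀ + δ)) := by
    rw [Set.mem_uIcc]
    rcases lt_or_gt_of_ne hs0 with hneg | hpos'
    · rw [abs_of_neg hneg] at h₁ h₂
      have := mul_pos hxD (neg_pos.2 hneg)
      left; constructor <;> simp only [hf] <;> linarith
    · rw [abs_of_pos hpos'] at h₁ h₂
      have := mul_pos hxD hpos'
      right; constructor <;> simp only [hf] <;> linarith
  obtain ⟨ψ, hψ, hψ0⟩ := intermediate_value_uIcc hfc.continuousOn hzero
  rw [Set.uIcc_of_le (by linarith)] at hψ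
  obtain ⟨hψI, hψh⟩ := hball (y := ψ) (by
    rw [Real.dist_eq, abs_lt]
    constructor <;> linarith [hψ.1, hψ.2])
  refine ⟨x, hxR, ψ, hψI, hψ0, ?_⟩
  have h₃ := (abs_le.1 (hxG ψ)).1
  have h₄ : x ^ N * (h ψ₀ / 2) < x ^ N * h ψ := by gcongr
  simp only [hh] at h₃ h₄ hxM ⊢
  linarith

/-- Among two consecutive zeros of `cos (a + D ψ)` one is not a zero of `cos (g + N ψ)`, if
`0 < N < D`. -/
theorem Real.exists_cos_add_mul_eq_zero_and_ne_zero (a g α : ℝ) {N D : ℕ} (hN : 0 < N)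
    (hND : N < D) :
    ∃ ψ ∈ Set.Ioc α (α + 2 * (π / D)),
      Real.cos (a + D * ψ) = 0 ∧ Real.cos (g + N * ψ) ≠ 0 := by
  have hD : (0 : ℝ) < D := by exact_mod_cast hN.trans hND
  have hp : 0 < π / D := div_pos Real.pi_pos hD
  set ψ := toIocMod hp α ((π / 2 - a) / D) with hψ
  obtain ⟨hψ₁, hψ₂⟩ := toIocMod_mem_Ioc hp α ((π / 2 - a) / D)
  rw [← hψ] at hψ₁ hψ₂
  have hcos : Real.cos (a + D * ψ) = 0 := by
    rw [Real.cos_eq_zero_iff]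
    refine ⟨-toIocDiv hp α ((π / 2 - a) / D), ?_⟩
    rw [hψ, toIocMod, zsmul_eq_mul]
    push_cast
    field_simp
    ring
  by_cases hg : Real.cos (g + N * ψ) = 0
  · refine ⟨ψ + π / D, ⟨by linarith, by linarith⟩, ?_, ?_⟩
    · rw [mul_add, mul_div_cancel₀ _ hD.ne', ← add_assoc, Real.cos_add_pi, hcos, neg_zero]
    · rw [mul_add, ← add_assoc, Real.cos_add, hg, zero_mul, zero_sub, neg_ne_zero]
      refine mul_ne_zero (fun h0 => ?_) (Real.sin_pos_of_pos_of_lt_pi ?_ ?_).ne'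
      · simpa [h0, hg] using Real.sin_sq_add_cos_sq (g + N * ψ)
      · have : (0 : ℝ) < N := by exact_mod_cast hN
        positivity
      · rw [← mul_div_assoc, div_lt_iff₀ hD, mul_comm]
        gcongr
  · exact ⟨ψ, ⟨hψ₁, by linarith⟩, hcos, hg⟩

theorem isOpen_setOf_polar_mem_Ioo (r α β : ℝ) (hr : 0 < r) :
    IsOpen {z : ℂ | ∃ ρ θ : ℝ, 0 < ρ ∧ ρ < r ∧ α < θ ∧ θ < β ∧
      z = ρ * Complex.exp (θ * Complex.I)} := by
  convert Complex.isOpenMap_exp _ ((isOpen_Iio (a := Real.log r)).reProdIm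
    (isOpen_Ioo (a := α) (b := β))) using 1
  ext z
  simp only [Set.mem_ofPred_eq, Set.mem_image, Complex.mem_reProdIm, Set.mem_Iio, Set.mem_Ioo]
  constructor
  · rintro ⟨ρ, θ, h₁, h₂, h₃, h₄, rfl⟩
    refine ⟨Real.log ρ + θ * Complex.I, ?_, ?_⟩
    · simpa [h₃, h₄] using Real.log_lt_log h₁ h₂
    · rw [Complex.exp_add, ← Complex.ofReal_exp, Real.exp_log h₁]
  · rintro ⟨w, ⟨h₁, h₂, h₃⟩, rfl⟩
    refine ⟨Real.exp w.re, w.im, Real.exp_pos _, (Real.lt_log_iff_exp_lt hr).1 h₁, h₂, h₃, ?_⟩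
    rw [Complex.ofReal_exp, ← Complex.exp_add, Complex.re_add_im]

/-- The reciprocal of a continuous `l`-th root on a sector of amplitude `2π` takes all
sufficiently large values in some sector of amplitude `2π / l`. -/
theorem exists_forall_exists_inv_root_eq {l : ℕ} (hl : 0 < l) {r τ₀ : ℝ} (hr : 0 < r)
    {ζ : ℂ → ℂ}
    (hζc : ContinuousOn ζ {z | ∃ ρ θ : ℝ, 0 < ρ ∧ ρ < r ∧ τ₀ < θ ∧ θ < τ₀ + 2 * π ∧
      z = ρ * Complex.exp (θ * Complex.I)})
    (hζ : ∀ z ∈ {z : ℂ | ∃ ρ θ : ℝ, 0 < ρ ∧ ρ < r ∧ τ₀ < θ ∧ θ < τ₀ + 2 * π ∧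
      z = ρ * Complex.exp (θ * Complex.I)}, ζ z ^ l = z) :
    ∃ α R : ℝ, ∀ x > R, ∀ ψ ∈ Set.Ioo α (α + 2 * π / l),
      ∃ z ∈ {z : ℂ | ∃ ρ θ : ℝ, 0 < ρ ∧ ρ < r ∧ τ₀ < θ ∧ θ < τ₀ + 2 * π ∧
        z = ρ * Complex.exp (θ * Complex.I)},
        (ζ z)⁻¹ = x * Complex.exp (ψ * Complex.I) := by
  set S := {z : ℂ | ∃ ρ θ : ℝ, 0 < ρ ∧ ρ < r ∧ τ₀ < θ ∧ θ < τ₀ + 2 * π ∧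
      z = ρ * Complex.exp (θ * Complex.I)} with hS
  have hl' : (0 : ℝ) < l := by exact_mod_cast hl
  have hlC : (l : ℂ) ≠ 0 := by exact_mod_cast hl.ne'
  set R : ℝ := max 1 r⁻¹ with hR
  have hR0 : ∀ {x}, R < x → 0 < x := fun {x} hx =>
    one_pos.trans ((le_max_left _ _).trans_lt hx)
  set w : ℝ × ℝ → ℂ := fun p =>
    ((p.1 ^ l)⁻¹ : ℝ) * Complex.exp (p.2 * Complex.I) with hw
  set T : Set (ℝ × ℝ) := Set.Ioi R ×ˢ Set.Ioo τ₀ (τ₀ + 2 * π) with hT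
  have hwS : Set.MapsTo w T S := by
    rintro ⟨x, θ⟩ ⟨hx, hθ⟩
    have hx' : R < x := hx
    have hx1 : 1 ≤ x := (le_max_left _ _).trans hx'.le
    have hx0 := hR0 hx'
    refine ⟨_, θ, inv_pos.2 (pow_pos hx0 l), ?_, hθ.1, hθ.2, rfl⟩
    calc (x ^ l)⁻¹ ≤ x⁻¹ := inv_anti₀ hx0 (le_self_pow₀ hx1 hl.ne')
      _ < r := inv_lt_of_inv_lt₀ hr ((le_max_right _ _).trans_lt hx')
  have hwc : ContinuousOn w T := by
    have : ContinuousOn (fun p : ℝ × ℝ => (p.1 ^ l)⁻¹) T :=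
      ContinuousOn.inv₀ (by fun_prop) fun p hp => (pow_pos (hR0 hp.1) l).ne'
    exact (Complex.continuous_ofReal.comp_continuousOn this).mul (by fun_prop)
  set q : ℝ × ℝ → ℂ := fun p =>
    ζ (w p) * (p.1 * Complex.exp (-(p.2 / l : ℝ) * Complex.I)) with hq
  have hqc : ContinuousOn q T := (hζc.comp hwc hwS).mul (by fun_prop)
  have hql : ∀ p ∈ T, q p ^ l = 1 := by
    intro p hp
    have hx0 : (p.1 : ℂ) ≠ 0 := by exact_mod_cast (hR0 hp.1).ne'
    rw [hq, mul_pow, hζ _ (hwS hp), mul_pow, ← Complex.exp_nat_mul, hw]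
    have : Complex.exp (p.2 * Complex.I) *
        Complex.exp (l * (-(p.2 / l : ℝ) * Complex.I)) = 1 := by
      rw [← Complex.exp_add, Complex.exp_eq_one_iff]
      refine ⟨0, ?_⟩
      push_cast
      field_simp
      ring
    push_cast at this ⊢
    rw [mul_mul_mul_comm, this, inv_mul_cancel₀ (pow_ne_zero _ hx0), one_mul]
  have hfin : {c : ℂ | c ^ l = 1}.Finite := by
    refine ((nthRoots l (1 : ℂ)).toFinset.finite_toSet).subset fun c hc => ?_
    simpa [mem_nthRoots hl] using hc
  obtain ⟨κ, hκ, hqκ⟩ := (isPreconnected_Ioi.prod isPreconnected_Ioo).eqOn_const_of_mapsTo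
    hfin.isDiscrete hqc hql ⟨1, one_pow l⟩
  have hκn : ‖κ‖ = 1 := Complex.norm_eq_one_of_pow_eq_one hκ hl.ne'
  have hκe : κ = Complex.exp (κ.arg * Complex.I) := by
    simpa [hκn] using (Complex.norm_mul_exp_arg_mul_I κ).symm
  refine ⟨-(τ₀ + 2 * π) / l - κ.arg, R, fun x hx ψ hψ => ?_⟩
  set θ : ℝ := -(l * (ψ + κ.arg)) with hθ
  have hψl : ψ = -(θ / l) - κ.arg := by rw [hθ]; field_simp; ring
  have hmem : (x, θ) ∈ T := by
    refine ⟨hx, ?_, ?_⟩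
    · have := hψ.2
      rw [hψl, ← sub_pos] at this
      have h2 : (-(τ₀ + 2 * π) / l - κ.arg + 2 * π / l - (-(θ / l) - κ.arg)) = (θ - τ₀) / l := by
        field_simp; ring
      rw [h2, div_pos_iff_of_pos_right hl'] at this
      exact sub_pos.1 this
    · have := hψ.1
      rw [hψl, ← sub_pos] at this
      have h2 : (-(θ / l) - κ.arg - (-(τ₀ + 2 * π) / l - κ.arg)) = (τ₀ + 2 * π - θ) / l := by
        field_simp; ring
      rw [h2, div_pos_iff_of_pos_right hl'] at this
      exact sub_pos.1 this
  refine ⟨w (x, θ), hwS hmem, ?_⟩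
  have h := hqκ hmem
  simp only [hq, Function.const_apply] at h
  rw [hκe] at h
  refine inv_eq_of_mul_eq_one_right ?_
  have hψe : Complex.exp (ψ * Complex.I) =
      Complex.exp (-(θ / l : ℝ) * Complex.I) * (Complex.exp (κ.arg * Complex.I))⁻¹ := by
    rw [← Complex.exp_neg, ← Complex.exp_add, hψl]
    congr 1
    push_cast
    ring
  rw [hψe, ← mul_assoc, ← mul_assoc, mul_assoc (ζ _), h, mul_inv_cancel₀ (Complex.exp_ne_zero _)]

/-- The polynomial whose value at `u⁻¹` is that of `polarPoly n a` at `u ^ l`. -/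
noncomputable def polarPolynomial (l n : ℕ) (a : ℕ → ℂ) : ℂ[X] :=
  ∑ j ∈ Finset.Icc 1 n, C (a j) * X ^ (l * j)

theorem eval_inv_polarPolynomial (l n : ℕ) (a : ℕ → ℂ) (u : ℂ) :
    (polarPolynomial l n a).eval u⁻¹ = polarPoly n a (u ^ l) := by
  simp [polarPolynomial, polarPoly, eval_finsetSum, pow_mul]

theorem natDegree_polarPolynomial_le (l n : ℕ) (a : ℕ → ℂ) :
    (polarPolynomial l n a).natDegree ≤ l * n :=
  natDegree_sum_le_of_forall_le _ _ fun _ hj => (natDegree_C_mul_X_pow_le _ _).trans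
    (Nat.mul_le_mul_left l (Finset.mem_Icc.1 hj).2)

theorem coeff_zero_polarPolynomial {l : ℕ} (hl : 0 < l) (n : ℕ) (a : ℕ → ℂ) :
    (polarPolynomial l n a).coeff 0 = 0 := by
  rw [polarPolynomial, finsetSum_coeff]
  refine Finset.sum_eq_zero fun j hj => ?_
  have := Finset.mem_Icc.1 hj
  rw [coeff_C_mul_X_pow, if_neg (Nat.mul_pos hl this.1).ne]

theorem coeff_mul_polarPolynomial {l n : ℕ} (hl : 0 < l) (hn : 0 < n) (a : ℕ → ℂ) :
    (polarPolynomial l n a).coeff (l * n) = a n := by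
  rw [polarPolynomial, finsetSum_coeff, Finset.sum_eq_single n]
  · simp
  · intro j _ hj
    rw [coeff_C_mul_X_pow, if_neg fun h => hj (Nat.eq_of_mul_eq_mul_left hl h).symm]
  · intro h
    exact absurd (Finset.mem_Icc.2 ⟨hn, le_rfl⟩) h

theorem Polynomial.natDegree_leadingCoeff_add_polarPolynomial {l m : ℕ} (hl : 0 < l)
    (hm : 0 < m) {b : ℕ → ℂ} (hb : b m ≠ 0) {A : ℂ[X]} (hA : A.natDegree < l * m) :
    (A + polarPolynomial l m b).natDegree = l * m ∧
      (A + polarPolynomial l m b).leadingCoeff = b m := by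
  have hc : (A + polarPolynomial l m b).coeff (l * m) = b m := by
    rw [coeff_add, coeff_eq_zero_of_natDegree_lt hA, zero_add, coeff_mul_polarPolynomial hl hm]
  have hd : (A + polarPolynomial l m b).natDegree = l * m :=
    natDegree_eq_of_le_of_coeff_ne_zero
      ((natDegree_add_le _ _).trans (max_le hA.le (natDegree_polarPolynomial_le _ _ _)))
      (hc ▸ hb)
  exact ⟨hd, by rw [leadingCoeff, hd, hc]⟩

/-- If `F₁` is continuous on the open set `S` and vanishing values of `re F₁` occur together with
arbitrarily large values of `re F₂`, an open subset of `S` separates them. -/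
theorem exists_isOpen_bddAbove_re_not_bddAbove_re {S : Set ℂ} (hS : IsOpen S)
    (hSb : Bornology.IsBounded S) {F₁ F₂ : ℂ → ℂ} (hF₁ : ContinuousOn F₁ S)
    (h : ∀ M : ℝ, ∃ z ∈ S, (F₁ z).re = 0 ∧ M < (F₂ z).re) :
    ∃ U : Set ℂ, U.Nonempty ∧ IsOpen U ∧ Bornology.IsBounded U ∧ U ⊆ S ∧
      (∃ B : ℝ, ∀ z ∈ U, (F₁ z).re ≤ B) ∧ ¬ ∃ B : ℝ, ∀ z ∈ U, (F₂ z).re ≤ B := by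
  have hsub : S ∩ (fun z => (F₁ z).re) ⁻¹' Set.Iio 1 ⊆ S := Set.inter_subset_left
  refine ⟨S ∩ (fun z => (F₁ z).re) ⁻¹' Set.Iio 1, ?_,
    (Complex.continuous_re.comp_continuousOn hF₁).isOpen_inter_preimage hS isOpen_Iio,
    hSb.subset hsub, hsub, ⟨1, fun z hz => le_of_lt hz.2⟩, ?_⟩
  · obtain ⟨z, hz, h0, -⟩ := h 0
    exact ⟨z, hz, by simp [h0]⟩
  · rintro ⟨B, hB⟩
    obtain ⟨z, hz, h0, hM⟩ := h B
    exact (hB z ⟨hz, by simp [h0]⟩).not_gt hM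

/-- Let `φ₁, φ₂` be polar polynomials of orders `n₁, n₂`, `ω` a
polar polynomial of order `m > n_j/l + 1`, `S` an open sector of amplitude
`2π`, and `ζ` a holomorphic `l`-th root of `z` on `S`.  Then `φ₁∘ζ ≠ φ₂∘ζ` on
`S` iff there is a nonempty bounded open subset of `S` on which one of
`Re(φ₁∘ζ + ω)`, `Re(φ₂∘ζ + ω)` is bounded above and the other is not. -/
theorem twisted_ramified_separation
    (l : ℕ) (hl : 0 < l) (n₁ n₂ m : ℕ) (a₁ a₂ b : ℕ → ℂ)
    (ha₁ : n₁ = 0 ∨ a₁ n₁ ≠ 0) (ha₂ : n₂ = 0 ∨ a₂ n₂ ≠ 0) (hb : b m ≠ 0)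
    (hm₁ : (n₁ : ℝ) / l + 1 < m) (hm₂ : (n₂ : ℝ) / l + 1 < m)
    (r τ₀ : ℝ) (hr : 0 < r) (S : Set ℂ)
    (hS : S = {z | ∃ ρ θ : ℝ, 0 < ρ ∧ ρ < r ∧ τ₀ < θ ∧ θ < τ₀ + 2 * π ∧
      z = ρ * Complex.exp (θ * Complex.I)})
    (ζ : ℂ → ℂ) (hζd : DifferentiableOn ℂ ζ S)
    (hζ : ∀ z ∈ S, ζ z ^ l = z) :
    (¬ ∀ z ∈ S, polarPoly n₁ a₁ (ζ z) = polarPoly n₂ a₂ (ζ z))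
      ↔
    ((∃ U : Set ℂ, U.Nonempty ∧ IsOpen U ∧ Bornology.IsBounded U ∧ U ⊆ S ∧
        (∃ B : ℝ, ∀ z ∈ U,
          (polarPoly n₁ a₁ (ζ z) + polarPoly m b z).re ≤ B) ∧
        ¬ (∃ B : ℝ, ∀ z ∈ U,
          (polarPoly n₂ a₂ (ζ z) + polarPoly m b z).re ≤ B))
      ∨
    (∃ V : Set ℂ, V.Nonempty ∧ IsOpen V ∧ Bornology.IsBounded V ∧ V ⊆ S ∧
        (∃ B : ℝ, ∀ z ∈ V,
          (polarPoly n₂ a₂ (ζ z) + polarPoly m b z).re ≤ B) ∧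
        ¬ (∃ B : ℝ, ∀ z ∈ V,
          (polarPoly n₁ a₁ (ζ z) + polarPoly m b z).re ≤ B))) := by
  constructor
  swap
  · rintro (⟨U, -, -, -, hU, ⟨B, hB⟩, hn⟩ | ⟨U, -, -, -, hU, ⟨B, hB⟩, hn⟩) heq
    · exact hn ⟨B, fun z hz => heq z (hU hz) ▸ hB z hz⟩
    · exact hn ⟨B, fun z hz => (heq z (hU hz)).symm ▸ hB z hz⟩
  intro hne
  have hl' : (0 : ℝ) < l := by exact_mod_cast hl
  have hlt : ∀ {n : ℕ}, (n : ℝ) / l + 1 < m → n < l * m := by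
    intro n h
    have h2 : (n : ℝ) / l < m := by linarith
    rw [div_lt_iff₀' hl'] at h2
    exact_mod_cast h2
  have hm : 1 < m := by
    have : (0 : ℝ) ≤ n₁ / l := by positivity
    have h2 : (1 : ℝ) < m := by linarith
    exact_mod_cast h2
  have hm0 : 0 < m := by lia
  set A₁ := polarPolynomial 1 n₁ a₁ with hA₁
  set A₂ := polarPolynomial 1 n₂ a₂ with hA₂
  set W := polarPolynomial l m b with hW
  have hd₁ : A₁.natDegree < l * m :=
    (natDegree_polarPolynomial_le 1 n₁ a₁).trans_lt (by simpa using hlt hm₁)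
  have hd₂ : A₂.natDegree < l * m :=
    (natDegree_polarPolynomial_le 1 n₂ a₂).trans_lt (by simpa using hlt hm₂)
  have hsplit : ∀ n a, ∀ z ∈ S, polarPoly n a (ζ z) + polarPoly m b z =
      (polarPolynomial 1 n a + W).eval (ζ z)⁻¹ := by
    intro n a z hz
    rw [eval_add, hW, eval_inv_polarPolynomial, eval_inv_polarPolynomial, hζ z hz, pow_one]
  have hSo : IsOpen S := hS ▸ isOpen_setOf_polar_mem_Ioo r τ₀ (τ₀ + 2 * π) hr
  have hSb : Bornology.IsBounded S := by
    refine (Metric.isBounded_ball (x := (0 : ℂ)) (r := r)).subset fun z hz => ?_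
    rw [hS] at hz
    obtain ⟨ρ, θ, h₁, h₂, -, -, rfl⟩ := hz
    simpa [abs_of_pos h₁] using h₂
  have hζ0 : ∀ z ∈ S, ζ z ≠ 0 := by
    intro z hz h0
    have h1 := hζ z hz
    rw [h0, zero_pow hl.ne'] at h1
    rw [hS] at hz
    obtain ⟨ρ, θ, h₁, -, -, -, rfl⟩ := hz
    exact mul_ne_zero (by exact_mod_cast h₁.ne') (Complex.exp_ne_zero _) h1.symm
  have hcont : ∀ n a, ContinuousOn (fun z => polarPoly n a (ζ z) + polarPoly m b z) S :=
    fun n a => ((polarPolynomial 1 n a + W).continuous.comp_continuousOn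
      (hζd.continuousOn.inv₀ hζ0)).congr (hsplit n a)
  set G := A₂ - A₁ with hG
  have hG0 : 0 < G.natDegree := by
    rw [Nat.pos_iff_ne_zero]
    intro h0
    rw [natDegree_eq_zero_iff_degree_le_zero] at h0
    rw [degree_le_zero_iff, hG, coeff_sub, hA₁, hA₂, coeff_zero_polarPolynomial one_pos,
      coeff_zero_polarPolynomial one_pos, sub_zero, C_0, sub_eq_zero] at h0
    refine hne fun z _ => ?_
    rw [← pow_one (ζ z), ← eval_inv_polarPolynomial, ← eval_inv_polarPolynomial, h0]
  have hGlt : G.natDegree < l * m := (natDegree_sub_le _ _).trans_lt (max_lt hd₂ hd₁)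
  obtain ⟨α, R, hαR⟩ := exists_forall_exists_inv_root_eq hl hr (hS ▸ hζd.continuousOn) (hS ▸ hζ)
  rw [← hS] at hαR
  obtain ⟨ψ₀, ⟨hψ₁, hψ₂⟩, hcos, hcosG⟩ :=
    Real.exists_cos_add_mul_eq_zero_and_ne_zero (b m).arg G.leadingCoeff.arg α hG0 hGlt
  have hψ : ψ₀ ∈ Set.Ioo α (α + 2 * π / l) := by
    refine ⟨hψ₁, hψ₂.trans_lt ?_⟩
    have hm1 : (1 : ℝ) < m := by exact_mod_cast hm
    rw [← mul_div_assoc]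
    push_cast
    gcongr
    nlinarith
  have key : ∀ n a n' a', (polarPolynomial 1 n a).natDegree < l * m →
      0 < (polarPolynomial 1 n' a' - polarPolynomial 1 n a).natDegree →
      0 < Real.cos ((polarPolynomial 1 n' a' - polarPolynomial 1 n a).leadingCoeff.arg +
        (polarPolynomial 1 n' a' - polarPolynomial 1 n a).natDegree * ψ₀) →
      ∀ M : ℝ, ∃ z ∈ S, (polarPoly n a (ζ z) + polarPoly m b z).re = 0 ∧
        M < (polarPoly n' a' (ζ z) + polarPoly m b z).re := by
    intro n a n' a' hd hdeg hpos M
    obtain ⟨hF, hFl⟩ := Polynomial.natDegree_leadingCoeff_add_polarPolynomial hl hm0 hb hd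
    obtain ⟨x, hx, ψ, hψ, h0, hM⟩ := Polynomial.exists_re_eval_eq_zero_and_lt_re_eval
      (by rw [hF]; positivity) hdeg hψ (by rw [hF, hFl]; exact hcos) hpos M R
    obtain ⟨z, hz, hzu⟩ := hαR x hx ψ hψ
    refine ⟨z, hz, ?_, ?_⟩
    · rw [hsplit n a z hz, hzu, h0]
    · rw [hsplit n' a' z hz, hzu]
      rw [← add_zero M, ← h0]
      refine (add_lt_add_left hM _).trans_eq ?_
      rw [← Complex.add_re, ← eval_add]
      congr 2
      ring
  rcases lt_or_gt_of_ne hcosG with hneg | hpos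
  · right
    refine exists_isOpen_bddAbove_re_not_bddAbove_re hSo hSb (hcont n₂ a₂)
      (key n₂ a₂ n₁ a₁ hd₂ ?_ ?_)
    · rwa [← hA₁, ← hA₂, ← neg_sub, natDegree_neg]
    · have hlc : G.leadingCoeff ≠ 0 := leadingCoeff_ne_zero.2 (ne_zero_of_natDegree_gt hG0)
      rw [← hA₁, ← hA₂, ← neg_sub, ← hG, natDegree_neg, leadingCoeff_neg]
      refine pos_of_mul_pos_right (a := ‖-G.leadingCoeff‖) ?_ (norm_nonneg _)
      have := Complex.re_mul_exp_ofReal_mul_I (-G.leadingCoeff) (G.natDegree * ψ₀)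
      rw [← this, neg_mul, Complex.neg_re, Complex.re_mul_exp_ofReal_mul_I, neg_pos]
      exact mul_neg_of_pos_of_neg (norm_pos_iff.2 hlc) hneg
  · left
    exact exists_isOpen_bddAbove_re_not_bddAbove_re hSo hSb (hcont n₁ a₁)
      (key n₁ a₁ n₂ a₂ hd₁ hG0 hpos)
end
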